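/- The map J : H → H̃ defined by Jx = {T_s x : s > 0} is an injective continuous linear map from (H,‖·‖) to (H̃,‖·‖_∼) whose range JH is dense in (H̃,‖·‖_∼); moreover, for every x̃ ∈ H̃, ‖J(x̃(t)) − x̃‖_∼ → 0 as t → 0⁺. Consequently (H̃,‖·‖_∼) is separable. -/

import Mathlib

open MeasureTheory Real Filter
open scoped ENNReal InnerProductSpace NNReal

noncomputable section

/-- A strongly continuous semigroup of bounded linear operators on `H`. -/
def IsC0 {H : Type*} [NormedAddCommGroup H] [NormedSpace ℝ H]
    (T : ℝ → H →L[ℝ] H) : Prop :=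
  T 0 = ContinuousLinearMap.id ℝ H ∧
  (∀ s t : ℝ, 0 ≤ s → 0 ≤ t → T (s + t) = (T s).comp (T t)) ∧
  ∀ x : H, ContinuousOn (fun t => T t x) (Set.Ici 0)

/-- An entrance path for `(T_t)` (normalized to vanish on `(-∞,0]`). -/
def IsEntrance {H : Type*} [NormedAddCommGroup H] [NormedSpace ℝ H]
    (T : ℝ → H →L[ℝ] H) (x : ℝ → H) : Prop :=
  (∀ s : ℝ, s ≤ 0 → x s = 0) ∧ ∀ r t : ℝ, 0 < r → 0 < t → x (r + t) = T t (x r)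

/-- Membership in the entrance space `H̃`: a locally square integrable entrance path. -/
def MemHt {H : Type*} [NormedAddCommGroup H] [NormedSpace ℝ H]
    (T : ℝ → H →L[ℝ] H) (x : ℝ → H) : Prop :=
  IsEntrance T x ∧ ∃ l > (0:ℝ), ∫⁻ s in Set.Ioo 0 l, (‖x s‖₊ : ℝ≥0∞) ^ 2 < ⊤

/-- The map `J : H → H̃`, `Jx = {T_s x : s > 0}`. -/
def Jmap {H : Type*} [NormedAddCommGroup H] [NormedSpace ℝ H]
    (T : ℝ → H →L[ℝ] H) (x : H) : ℝ → H :=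
  fun s => if 0 < s then T s x else 0

open Set Topology

section Weighted

variable {H : Type*} [NormedAddCommGroup H]

lemma lintegral_weighted_norm_sq_le {c₀ b₀ b R : ℝ} (hb : b₀ < b) {S : Set ℝ}
    (hS : MeasurableSet S) (hS0 : S ⊆ Ioi 0) {f : ℝ → H}
    (hf : ∀ s ∈ S, ‖f s‖ ≤ c₀ * exp (b₀ * s) * R) :
    ∫⁻ s in S, ENNReal.ofReal (exp (-2 * b * s) * ‖f s‖ ^ 2) ≤
      ENNReal.ofReal (c₀ ^ 2 * (∫ s in Ioi (0 : ℝ), exp (-(2 * (b - b₀)) * s)) * R ^ 2) := by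
  have hint : IntegrableOn (fun s : ℝ => exp (-(2 * (b - b₀)) * s)) (Ioi 0) :=
    exp_neg_integrableOn_Ioi 0 (by linarith)
  calc ∫⁻ s in S, ENNReal.ofReal (exp (-2 * b * s) * ‖f s‖ ^ 2)
      ≤ ∫⁻ s in S, ENNReal.ofReal (c₀ ^ 2 * R ^ 2 * exp (-(2 * (b - b₀)) * s)) := by
        refine setLIntegral_mono' hS fun s hs => ENNReal.ofReal_le_ofReal ?_
        have hexp : exp (-(2 * (b - b₀)) * s) = exp (-2 * b * s) * exp (b₀ * s) ^ 2 := by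
          rw [← exp_nat_mul, ← exp_add]; congr 1; push_cast; ring
        calc exp (-2 * b * s) * ‖f s‖ ^ 2
            ≤ exp (-2 * b * s) * (c₀ * exp (b₀ * s) * R) ^ 2 := by gcongr; exact hf s hs
          _ = c₀ ^ 2 * R ^ 2 * exp (-(2 * (b - b₀)) * s) := by rw [hexp]; ring
    _ ≤ ∫⁻ s in Ioi 0, ENNReal.ofReal (c₀ ^ 2 * R ^ 2 * exp (-(2 * (b - b₀)) * s)) :=
        lintegral_mono_set hS0
    _ = _ := by
        rw [← ofReal_integral_eq_lintegral_ofReal (hint.const_mul _)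
          (Eventually.of_forall fun s => by positivity), integral_const_mul]
        congr 1; ring

lemma ofReal_weighted_norm_sub_sq_le (b s : ℝ) (u v w : H) :
    ENNReal.ofReal (exp (-2 * b * s) * ‖u - w‖ ^ 2) ≤
      2 * ENNReal.ofReal (exp (-2 * b * s) * ‖u - v‖ ^ 2) +
        2 * ENNReal.ofReal (exp (-2 * b * s) * ‖v - w‖ ^ 2) := by
  rw [show (2 : ℝ≥0∞) = ENNReal.ofReal 2 by simp, ← ENNReal.ofReal_mul (by norm_num),
    ← ENNReal.ofReal_mul (by norm_num), ← ENNReal.ofReal_add (by positivity) (by positivity)]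
  refine ENNReal.ofReal_le_ofReal ?_
  have h : ‖u - w‖ ^ 2 ≤ 2 * ‖u - v‖ ^ 2 + 2 * ‖v - w‖ ^ 2 := by
    have h1 : ‖u - w‖ ≤ ‖u - v‖ + ‖v - w‖ := norm_sub_le_norm_sub_add_norm_sub u v w
    have h2 := pow_le_pow_left₀ (norm_nonneg _) h1 2
    nlinarith [sq_nonneg (‖u - v‖ - ‖v - w‖)]
  nlinarith [mul_le_mul_of_nonneg_left h (exp_pos (-2 * b * s)).le]

lemma ofReal_weighted_norm_sub_sq_le_nnnorm {b s : ℝ} (hb : 0 ≤ b) (hs : 0 ≤ s) (u v : H) :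
    ENNReal.ofReal (exp (-2 * b * s) * ‖u - v‖ ^ 2) ≤
      2 * (‖u‖₊ : ℝ≥0∞) ^ 2 + 2 * (‖v‖₊ : ℝ≥0∞) ^ 2 := by
  have hsq (w : H) : (‖w‖₊ : ℝ≥0∞) ^ 2 = ENNReal.ofReal (‖w‖ ^ 2) := by
    rw [ENNReal.ofReal_pow (norm_nonneg _), ofReal_norm, enorm_eq_nnnorm]
  have hexp : exp (-2 * b * s) ≤ 1 := exp_le_one_iff.2 (by nlinarith [mul_nonneg hb hs])
  have h := ofReal_weighted_norm_sub_sq_le b s u 0 v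
  rw [sub_zero, zero_sub, norm_neg] at h
  refine h.trans ?_
  rw [hsq, hsq]
  gcongr <;> exact mul_le_of_le_one_left (by positivity) hexp

end Weighted

section Semigroup

variable {H : Type*} [NormedAddCommGroup H] [NormedSpace ℝ H] {T : ℝ → H →L[ℝ] H}

lemma IsEntrance.continuousOn (hT : IsC0 T) {x : ℝ → H} (hx : IsEntrance T x) :
    ContinuousOn x (Ioi 0) := by
  intro s hs
  have hs : 0 < s := hs
  have h2 : 0 < s / 2 := by linarith
  have hc : ContinuousAt (fun u => T (u - s / 2) (x (s / 2))) s := by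
    have h1 : ContinuousAt (fun t => T t (x (s / 2))) (s - s / 2) :=
      (hT.2.2 _).continuousAt (Ici_mem_nhds (by linarith))
    exact ContinuousAt.comp (f := fun u => u - s / 2) h1 (by fun_prop)
  refine (hc.congr ?_).continuousWithinAt
  filter_upwards [Ioi_mem_nhds (show s / 2 < s by linarith)] with u hu
  rw [← hx.2 (s / 2) (u - s / 2) h2 (sub_pos.2 hu)]
  congr 1; ring

lemma memHt_Jmap {c₀ b₀ : ℝ} (hc₀ : 0 ≤ c₀) (hb₀ : 0 ≤ b₀) (hT : IsC0 T)
    (hbd : ∀ t : ℝ, 0 ≤ t → ‖T t‖ ≤ c₀ * exp (b₀ * t)) (x : H) : MemHt T (Jmap T x) := by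
  refine ⟨⟨fun s hs => if_neg hs.not_gt, fun r t hr ht => ?_⟩, 1, one_pos, ?_⟩
  · simp only [Jmap, if_pos hr, if_pos (add_pos hr ht)]
    rw [add_comm, hT.2.1 t r ht.le hr.le]; rfl
  · refine lt_of_le_of_lt (setLIntegral_mono' (g := fun _ =>
      ENNReal.ofReal (c₀ * exp b₀ * ‖x‖) ^ 2) measurableSet_Ioo fun s hs => ?_) ?_
    · gcongr
      rw [← enorm_eq_nnnorm, ← ofReal_norm]
      refine ENNReal.ofReal_le_ofReal ?_
      simp only [Jmap, if_pos hs.1]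
      refine (T s).le_of_opNorm_le ((hbd s hs.1.le).trans ?_) x
      gcongr
      nlinarith [hs.2]
    · rw [setLIntegral_const]
      exact ENNReal.mul_lt_top (ENNReal.pow_lt_top ENNReal.ofReal_lt_top) (by simp)

lemma IsC0.eq_of_forall_pos (hT : IsC0 T) {x y : H} (h : ∀ s : ℝ, 0 < s → T s x = T s y) :
    x = y := by
  have hlim (z : H) : Tendsto (fun s => T s z) (𝓝[>] 0) (𝓝 z) := by
    have := ((hT.2.2 z) 0 self_mem_Ici).tendsto.mono_left (nhdsWithin_mono _ Ioi_subset_Ici_self)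
    simpa [hT.1] using this
  refine tendsto_nhds_unique (hlim x) ((hlim y).congr' ?_)
  filter_upwards [self_mem_nhdsWithin] with s hs using (h s hs).symm

lemma lintegral_semigroup_le {c₀ b₀ b : ℝ} (hb : b₀ < b)
    (hbd : ∀ t : ℝ, 0 ≤ t → ‖T t‖ ≤ c₀ * exp (b₀ * t)) (x : H) :
    ∫⁻ s in Ioi 0, ENNReal.ofReal (exp (-2 * b * s) * ‖T s x‖ ^ 2) ≤
      ENNReal.ofReal
        (c₀ ^ 2 * (∫ s in Ioi (0 : ℝ), exp (-(2 * (b - b₀)) * s)) * ‖x‖ ^ 2) :=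
  lintegral_weighted_norm_sq_le hb measurableSet_Ioi subset_rfl fun s hs =>
    (T s).le_of_opNorm_le (hbd s (mem_Ioi.1 hs).le) x

lemma MemHt.exists_pos_setLIntegral_lt {x : ℝ → H} (hx : MemHt T x) {ε : ℝ≥0∞} (hε : ε ≠ 0) :
    ∃ δ > (0 : ℝ), ∫⁻ s in Ioo 0 (2 * δ), (‖x s‖₊ : ℝ≥0∞) ^ 2 < ε := by
  obtain ⟨l, hl, hfin⟩ := hx.2
  obtain ⟨η, hη, h⟩ := exists_pos_setLIntegral_lt_of_measure_lt hfin.ne hε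
  obtain ⟨r, hr, hrη⟩ := ENNReal.lt_iff_exists_real_btwn.1 hη
  have hr0 : 0 < r := ENNReal.ofReal_pos.1 hrη.1
  have hm : 0 < min r l := lt_min hr0 hl
  refine ⟨min r l / 2, by linarith, ?_⟩
  rw [mul_div_cancel₀ _ two_ne_zero]
  have h1 := h (Ioo 0 (min r l)) (lt_of_le_of_lt (Measure.restrict_apply_le _ _) (by
    rw [Real.volume_Ioo, sub_zero]
    exact (ENNReal.ofReal_le_ofReal (min_le_left _ _)).trans_lt hrη.2))
  rwa [Measure.restrict_restrict measurableSet_Ioo,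
    inter_eq_left.2 (Ioo_subset_Ioo_right (min_le_right _ _))] at h1

lemma setLIntegral_comp_add_right_le (f : ℝ → ℝ≥0∞) {δ t : ℝ} (ht : 0 ≤ t) (htδ : t < δ) :
    ∫⁻ s in Ioc 0 δ, f (s + t) ≤ ∫⁻ s in Ioo 0 (2 * δ), f s := by
  have hpre : (fun s => s + t) ⁻¹' Ioc t (δ + t) = Ioc 0 δ := by ext s; simp
  rw [← hpre, (measurePreserving_add_right volume t).setLIntegral_comp_preimage_emb
    (measurableEmbedding_addRight t)]
  exact lintegral_mono_set fun s hs => ⟨ht.trans_lt hs.1, by linarith [hs.2]⟩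

lemma MemHt.tendsto_lintegral {c₀ b₀ b : ℝ} (hc₀ : 0 ≤ c₀) (hb₀ : 0 ≤ b₀) (hb : b₀ < b)
    (hT : IsC0 T) (hbd : ∀ t : ℝ, 0 ≤ t → ‖T t‖ ≤ c₀ * exp (b₀ * t))
    {x : ℝ → H} (hx : MemHt T x) :
    Tendsto (fun t => ∫⁻ s in Ioi 0,
      ENNReal.ofReal (exp (-2 * b * s) * ‖T s (x t) - x s‖ ^ 2)) (𝓝[>] 0) (𝓝 0) := by
  set C := c₀ ^ 2 * ∫ s in Ioi (0 : ℝ), exp (-(2 * (b - b₀)) * s)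
  have hcont : ContinuousOn x (Ioi 0) := hx.1.continuousOn hT
  refine ENNReal.tendsto_nhds_zero.2 fun ε hε => ?_
  have hε8 : ε / 8 ≠ 0 := (ENNReal.div_pos hε.ne' (by norm_num)).ne'
  obtain ⟨δ, hδ, hsmall⟩ := hx.exists_pos_setLIntegral_lt hε8
  have htail : Tendsto (fun t => ENNReal.ofReal (C * ‖x (t + δ) - x δ‖ ^ 2)) (𝓝[>] 0) (𝓝 0) := by
    have hx' : ContinuousAt x (0 + δ) := by
      rw [zero_add]; exact hcont.continuousAt (Ioi_mem_nhds hδ)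
    have h1 : ContinuousAt (fun t => x (t + δ)) 0 :=
      ContinuousAt.comp (f := fun t : ℝ => t + δ) hx' (by fun_prop)
    have h2 : ContinuousAt (fun t => ENNReal.ofReal (C * ‖x (t + δ) - x δ‖ ^ 2)) 0 :=
      ENNReal.continuous_ofReal.continuousAt.comp
        (((h1.sub continuousAt_const).norm.pow 2).const_mul C)
    simpa using h2.tendsto.mono_left (nhdsWithin_le_nhds (s := Ioi 0))
  filter_upwards [ENNReal.tendsto_nhds_zero.1 htail (ε / 2) (ENNReal.half_pos hε.ne'),
    Ioo_mem_nhdsGT hδ] with t htε ht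
  have hhead : ∫⁻ s in Ioc 0 δ, ENNReal.ofReal (exp (-2 * b * s) * ‖T s (x t) - x s‖ ^ 2)
      ≤ ε / 2 := by
    have hmeas : AEMeasurable (fun s => 2 * (‖x s‖₊ : ℝ≥0∞) ^ 2) (volume.restrict (Ioc 0 δ)) := by
      have h1 : ContinuousOn (fun s => ‖x s‖₊) (Ioc 0 δ) :=
        (hcont.mono fun s hs => hs.1).nnnorm
      exact ((h1.aemeasurable measurableSet_Ioc).coe_nnreal_ennreal.pow_const 2).const_mul 2
    calc ∫⁻ s in Ioc 0 δ, ENNReal.ofReal (exp (-2 * b * s) * ‖T s (x t) - x s‖ ^ 2)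
        ≤ ∫⁻ s in Ioc 0 δ, (2 * (‖x (s + t)‖₊ : ℝ≥0∞) ^ 2 + 2 * (‖x s‖₊ : ℝ≥0∞) ^ 2) := by
          refine setLIntegral_mono' measurableSet_Ioc fun s hs => ?_
          rw [← hx.1.2 t s ht.1 hs.1, add_comm t s]
          exact ofReal_weighted_norm_sub_sq_le_nnnorm (hb₀.trans hb.le) hs.1.le _ _
      _ = (2 * ∫⁻ s in Ioc 0 δ, (‖x (s + t)‖₊ : ℝ≥0∞) ^ 2) +
            2 * ∫⁻ s in Ioc 0 δ, (‖x s‖₊ : ℝ≥0∞) ^ 2 := by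
          rw [lintegral_add_right' _ hmeas, lintegral_const_mul' _ _ (by simp),
            lintegral_const_mul' _ _ (by simp)]
      _ ≤ 2 * (ε / 8) + 2 * (ε / 8) := by
          gcongr
          · exact (setLIntegral_comp_add_right_le (fun s => (‖x s‖₊ : ℝ≥0∞) ^ 2)
              ht.1.le ht.2).trans hsmall.le
          · refine (lintegral_mono_set fun s hs => ?_).trans hsmall.le
            exact ⟨hs.1, by linarith [hs.2]⟩
      _ = ε / 2 := by
          rw [← add_mul, div_eq_mul_inv, mul_left_comm, div_eq_mul_inv]
          congr 1
          rw [show (8 : ℝ≥0∞) = (2 + 2) * 2 by norm_num,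
            ENNReal.mul_inv (by norm_num) (by norm_num), ← mul_assoc,
            ENNReal.mul_inv_cancel (by norm_num) (by norm_num), one_mul]
  have htail' : ∫⁻ s in Ioi δ, ENNReal.ofReal (exp (-2 * b * s) * ‖T s (x t) - x s‖ ^ 2)
      ≤ ε / 2 := by
    refine (lintegral_weighted_norm_sq_le hb measurableSet_Ioi (Ioi_subset_Ioi hδ.le)
      fun s hs => ?_).trans htε
    have hs : δ < s := hs
    have h1 : T s (x t) - x s = T (s - δ) (x (t + δ) - x δ) := by
      rw [map_sub, ← hx.1.2 t s ht.1 (hδ.trans hs),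
        ← hx.1.2 _ _ (add_pos ht.1 hδ) (sub_pos.2 hs), ← hx.1.2 _ _ hδ (sub_pos.2 hs)]
      congr 2 <;> ring
    rw [h1]
    refine (T (s - δ)).le_of_opNorm_le ((hbd _ (sub_pos.2 hs).le).trans ?_) _
    gcongr
    linarith
  rw [← Ioc_union_Ioi_eq_Ioi hδ.le]
  exact (lintegral_union_le _ _ _).trans ((add_le_add hhead htail').trans_eq (ENNReal.add_halves ε))

lemma exists_mem_lintegral_semigroup_sub_lt {c₀ b₀ b : ℝ} (hb : b₀ < b) (hT : IsC0 T)
    (hbd : ∀ t : ℝ, 0 ≤ t → ‖T t‖ ≤ c₀ * exp (b₀ * t)) {s : Set H} (hs : Dense s)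
    {x : ℝ → H} {y : H} {ε : ℝ} (hε : 0 < ε)
    (hy : ∫⁻ s in Ioi 0, ENNReal.ofReal (exp (-2 * b * s) * ‖T s y - x s‖ ^ 2) <
      ENNReal.ofReal (ε / 4)) :
    ∃ z ∈ s, ∫⁻ s in Ioi 0, ENNReal.ofReal (exp (-2 * b * s) * ‖T s z - x s‖ ^ 2) <
      ENNReal.ofReal ε := by
  set C := c₀ ^ 2 * ∫ s in Ioi (0 : ℝ), exp (-(2 * (b - b₀)) * s)
  have hopen : IsOpen {z : H | C * ‖z - y‖ ^ 2 < ε / 4} :=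
    isOpen_lt (by fun_prop) continuous_const
  obtain ⟨z, hz, hzs⟩ := hs.exists_mem_open hopen ⟨y, by simp [hε]⟩
  refine ⟨z, hz, ?_⟩
  have hmeas : AEMeasurable (fun s => 2 * ENNReal.ofReal (exp (-2 * b * s) * ‖T s z - T s y‖ ^ 2))
      (volume.restrict (Ioi 0)) := by
    have h1 : ContinuousOn (fun s => exp (-2 * b * s) * ‖T s z - T s y‖ ^ 2) (Ioi 0) := by
      have h2 (w : H) : ContinuousOn (fun s => T s w) (Ioi 0) :=
        (hT.2.2 w).mono Ioi_subset_Ici_self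
      exact (by fun_prop : Continuous fun s : ℝ => exp (-2 * b * s)).continuousOn.mul
        (((h2 z).sub (h2 y)).norm.pow 2)
    exact (h1.aemeasurable measurableSet_Ioi).ennreal_ofReal.const_mul 2
  have hzy : ∫⁻ s in Ioi 0, ENNReal.ofReal (exp (-2 * b * s) * ‖T s z - T s y‖ ^ 2) <
      ENNReal.ofReal (ε / 4) := by
    simp_rw [← map_sub]
    exact (lintegral_semigroup_le hb hbd (z - y)).trans_lt
      ((ENNReal.ofReal_lt_ofReal_iff (by linarith)).2 hzs)
  calc ∫⁻ s in Ioi 0, ENNReal.ofReal (exp (-2 * b * s) * ‖T s z - x s‖ ^ 2)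
      ≤ ∫⁻ s in Ioi 0, (2 * ENNReal.ofReal (exp (-2 * b * s) * ‖T s z - T s y‖ ^ 2) +
          2 * ENNReal.ofReal (exp (-2 * b * s) * ‖T s y - x s‖ ^ 2)) :=
        lintegral_mono fun s => ofReal_weighted_norm_sub_sq_le b s _ _ _
    _ = (2 * ∫⁻ s in Ioi 0, ENNReal.ofReal (exp (-2 * b * s) * ‖T s z - T s y‖ ^ 2)) +
          2 * ∫⁻ s in Ioi 0, ENNReal.ofReal (exp (-2 * b * s) * ‖T s y - x s‖ ^ 2) := by
        rw [lintegral_add_left' hmeas, lintegral_const_mul' _ _ (by simp),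
          lintegral_const_mul' _ _ (by simp)]
    _ < 2 * ENNReal.ofReal (ε / 4) + 2 * ENNReal.ofReal (ε / 4) := by
        refine ENNReal.add_lt_add ?_ ?_ <;>
          exact ENNReal.mul_lt_mul_right (by simp) (by simp) ‹_›
    _ = ENNReal.ofReal ε := by
        rw [show (2 : ℝ≥0∞) = ENNReal.ofReal 2 by simp, ← ENNReal.ofReal_mul (by norm_num),
          ← ENNReal.ofReal_add (by positivity) (by positivity)]
        congr 1; ring

end Semigroup

/-- **Lemma 2.3.** `J : x ↦ {T_s x : s > 0}` is an injective continuous linear map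
from `(H,‖·‖)` to `(H̃,‖·‖_∼)` with dense range; moreover `‖J(x̃(t)) - x̃‖_∼ → 0` as
`t → 0⁺` for every `x̃ ∈ H̃`.  Consequently `(H̃,‖·‖_∼)` is separable. -/
theorem Jmap_dense_embedding
    {H : Type*} [NormedAddCommGroup H] [InnerProductSpace ℝ H] [CompleteSpace H]
    [SecondCountableTopology H]
    (T : ℝ → H →L[ℝ] H) (c₀ b₀ b : ℝ) (hc₀ : 0 ≤ c₀) (hb₀ : 0 ≤ b₀) (hb : b₀ < b)
    (hT : IsC0 T) (hbd : ∀ t : ℝ, 0 ≤ t → ‖T t‖ ≤ c₀ * Real.exp (b₀ * t)) :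
    -- `J` maps `H` into the entrance space `H̃`
    (∀ x : H, MemHt T (Jmap T x)) ∧
    -- `J` is linear
    (∀ x y : H, Jmap T (x + y) = Jmap T x + Jmap T y) ∧
    (∀ (c : ℝ) (x : H), Jmap T (c • x) = c • Jmap T x) ∧
    -- `J` is injective
    (∀ x y : H, (∀ s : ℝ, 0 < s → T s x = T s y) → x = y) ∧
    -- `J` is continuous: `‖Jx‖_∼² ≤ C ‖x‖²`
    (∃ C : ℝ, 0 ≤ C ∧ ∀ x : H,
      ∫⁻ s in Set.Ioi 0, ENNReal.ofReal (Real.exp (-2 * b * s) * ‖T s x‖ ^ 2)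
        ≤ ENNReal.ofReal (C * ‖x‖ ^ 2)) ∧
    -- `‖J(x̃(t)) - x̃‖_∼ → 0` as `t → 0⁺`, for every `x̃ ∈ H̃`
    (∀ x : ℝ → H, MemHt T x →
      Tendsto (fun t => ∫⁻ s in Set.Ioi 0,
          ENNReal.ofReal (Real.exp (-2 * b * s) * ‖T s (x t) - x s‖ ^ 2))
        (nhdsWithin 0 (Set.Ioi 0)) (nhds 0)) ∧
    -- `JH` is dense in `(H̃, ‖·‖_∼)`
    (∀ x : ℝ → H, MemHt T x → ∀ ε : ℝ, 0 < ε → ∃ y : H,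
      ∫⁻ s in Set.Ioi 0, ENNReal.ofReal (Real.exp (-2 * b * s) * ‖T s y - x s‖ ^ 2)
        < ENNReal.ofReal ε) ∧
    -- consequently `(H̃, ‖·‖_∼)` is separable
    (∃ D : Set (ℝ → H), D.Countable ∧ (∀ z ∈ D, MemHt T z) ∧
      ∀ x : ℝ → H, MemHt T x → ∀ ε : ℝ, 0 < ε → ∃ z ∈ D,
        ∫⁻ s in Set.Ioi 0, ENNReal.ofReal (Real.exp (-2 * b * s) * ‖z s - x s‖ ^ 2)
          < ENNReal.ofReal ε) := by
  have hdense : ∀ x : ℝ → H, MemHt T x → ∀ ε : ℝ, 0 < ε → ∃ y : H,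
      ∫⁻ s in Set.Ioi 0, ENNReal.ofReal (Real.exp (-2 * b * s) * ‖T s y - x s‖ ^ 2)
        < ENNReal.ofReal ε := fun x hx ε hε =>
    let ⟨t, ht⟩ := ((hx.tendsto_lintegral hc₀ hb₀ hb hT hbd).eventually_lt_const
      (ENNReal.ofReal_pos.2 hε)).exists
    ⟨x t, ht⟩
  refine ⟨memHt_Jmap hc₀ hb₀ hT hbd, fun x y => ?_, fun c x => ?_,
    fun x y => hT.eq_of_forall_pos, ⟨_, ?_, lintegral_semigroup_le hb hbd⟩,
    fun x hx => hx.tendsto_lintegral hc₀ hb₀ hb hT hbd, hdense, ?_⟩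
  · ext s
    by_cases hs : 0 < s <;> simp [Jmap, hs]
  · ext s
    by_cases hs : 0 < s <;> simp [Jmap, hs]
  · exact mul_nonneg (sq_nonneg _) (integral_nonneg fun s => (exp_pos _).le)
  · obtain ⟨s, hsc, hsd⟩ := TopologicalSpace.exists_countable_dense H
    refine ⟨Jmap T '' s, hsc.image _, ?_, fun x hx ε hε => ?_⟩
    · rintro _ ⟨y, -, rfl⟩
      exact memHt_Jmap hc₀ hb₀ hT hbd y
    · obtain ⟨y, hy⟩ := hdense x hx (ε / 4) (by linarith)
      obtain ⟨z, hz, hlt⟩ := exists_mem_lintegral_semigroup_sub_lt hb hT hbd hsd hε hy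
      refine ⟨_, mem_image_of_mem _ hz, lt_of_eq_of_lt ?_ hlt⟩
      refine setLIntegral_congr_fun measurableSet_Ioi fun s hs => ?_
      simp only [Jmap, if_pos (mem_Ioi.1 hs)]
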